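/- Let A = ℂ[[x,y]] be the formal power series ring in two variables over ℂ, let f ∈ A be a nonzero non-unit such that O = A/(f) is reduced, and let M be a nonzero finitely generated O-module that is torsion free, i.e. every element of O that is not a zero divisor acts injectively on M. Then the minimal number of generators of M as an O-module equals the minimal number of generators of Hom_O(M, O) as an O-module. -/

import Mathlib

/-- The minimal number of generators of an `R`-module `M`: the least `r` such that
there is a surjective `R`-linear map `R^r → M`. -/
noncomputable def minGens (R : Type*) [CommRing R] (M : Type*) [AddCommGroup M]
    [Module R M] : ℕ :=
  sInf {r : ℕ | ∃ φ : (Fin r → R) →ₗ[R] M, Function.Surjective φ}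

/-- A `t`-saturated submodule of `A^n` is free if `A/t` is a PID. -/
lemma exists_free_gens {A B : Type*} [CommRing A] [IsDomain A] [IsLocalRing A]
    [IsNoetherianRing A] [CommRing B] [IsDomain B] [IsPrincipalIdealRing B]
    (ev : A →+* B) (hs : Function.Surjective ev) (t : A) (ht0 : t ≠ 0) (htu : ¬ IsUnit t)
    (hker : ∀ a, ev a = 0 → t ∣ a) {n : ℕ}
    (K : Submodule A (Fin n → A)) (hK : ∀ v, t • v ∈ K → v ∈ K) :
    ∃ (m : ℕ) (k : Fin m → (Fin n → A)), LinearIndependent A k ∧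
      Submodule.span A (Set.range k) = K := by
  have hjac : Ideal.span {t} ≤ Ideal.jacobson (⊥ : Ideal A) := by
    rw [IsLocalRing.jacobson_eq_maximalIdeal ⊥ bot_ne_top, Ideal.span_singleton_le_iff_mem]
    exact (IsLocalRing.mem_maximalIdeal t).2 htu
  let N : Submodule B (Fin n → B) :=
    { carrier := {w | ∃ v ∈ K, w = fun i => ev (v i)}
      add_mem' := by
        rintro _ _ ⟨v, hv, rfl⟩ ⟨w, hw, rfl⟩
        exact ⟨v + w, K.add_mem hv hw, by ext i; simp⟩
      zero_mem' := ⟨0, K.zero_mem, by ext i; simp⟩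
      smul_mem' := by
        rintro c _ ⟨v, hv, rfl⟩
        obtain ⟨a, rfl⟩ := hs c
        exact ⟨a • v, K.smul_mem a hv, by ext i; simp⟩ }
  obtain ⟨m, ⟨b⟩⟩ := N.nonempty_basis_of_pid (Pi.basisFun B (Fin n))
  have hb : ∀ j, ∃ v ∈ K, ((b j : N) : Fin n → B) = fun i => ev (v i) := fun j => (b j).2
  choose k hkK hkb using hb
  refine ⟨m, k, ?_, le_antisymm ?_ ?_⟩
  · rw [Fintype.linearIndependent_iff]
    let L : Submodule A (Fin m → A) := LinearMap.ker (Fintype.linearCombination A k)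
    have hL : L = ⊥ := by
      refine Submodule.eq_bot_of_le_smul_of_le_jacobson_bot (Ideal.span {t}) L
        (IsNoetherian.noetherian L) ?_ hjac
      intro a ha
      have ha' : ∑ j, a j • k j = 0 := by
        simpa [L, Fintype.linearCombination_apply] using ha
      have h0 : ∑ j, ev (a j) • b j = 0 := by
        apply Subtype.ext
        rw [Submodule.coe_sum]
        ext i
        have := congrArg (fun v => ev (v i)) ha'
        simpa [hkb, Finset.sum_apply] using this
      have h1 := Fintype.linearIndependent_iff.1 b.linearIndependent _ h0
      choose c hc using fun j => hker _ (h1 j)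
      have hac : a = t • c := by ext j; simp [hc]
      rw [hac]
      refine Submodule.smul_mem_smul (Ideal.mem_span_singleton_self t) ?_
      have h2 : t • ∑ j, c j • k j = 0 := by
        rw [← ha', Finset.smul_sum]
        exact Finset.sum_congr rfl fun j _ => by rw [hc j, mul_smul]
      have h3 := (smul_eq_zero.1 h2).resolve_left ht0
      simpa [L, Fintype.linearCombination_apply] using h3
    intro g hg
    have : g ∈ L := by simpa [L, Fintype.linearCombination_apply] using hg
    rw [hL, Submodule.mem_bot] at this
    simp [this]
  · rw [Submodule.span_le]
    rintro _ ⟨j, rfl⟩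
    exact hkK j
  · refine Submodule.le_of_le_smul_of_le_jacobson_bot (IsNoetherian.noetherian K) hjac ?_
    intro v hv
    let w : N := ⟨fun i => ev (v i), v, hv, rfl⟩
    choose a ha using fun j => hs (b.repr w j)
    have hw : ∑ j, ev (a j) • b j = w := by
      simp only [ha]; exact b.sum_repr w
    have hw' : ∀ i, ∑ j, ev (a j) * ev (k j i) = ev (v i) := by
      intro i
      have := congrArg (fun x : N => (x : Fin n → B) i) hw
      simpa [hkb, Finset.sum_apply, w] using this
    have hd : ∀ i, t ∣ (v - ∑ j, a j • k j) i := by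
      intro i
      apply hker
      simp [Finset.sum_apply, hw']
    choose u hu using hd
    have hu' : v - ∑ j, a j • k j = t • u := by ext i; simp [← hu]
    have hsum : ∑ j, a j • k j ∈ K := K.sum_mem fun j _ => K.smul_mem _ (hkK j)
    have huK : u ∈ K := hK u (hu' ▸ K.sub_mem hv hsum)
    rw [← sub_add_cancel v (∑ j, a j • k j), hu', add_comm]
    refine Submodule.add_mem_sup ?_
      (Submodule.smul_mem_smul (Ideal.mem_span_singleton_self t) huK)
    exact Submodule.sum_mem _ fun j _ => Submodule.smul_mem _ _
      (Submodule.subset_span ⟨j, rfl⟩)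

/-- Generators whose relations all have coefficients in the maximal ideal are minimal. -/
lemma minGens_eq_of_rel {R N : Type*} [CommRing R] [IsLocalRing R] [AddCommGroup N] [Module R N]
    {n : ℕ} (G : Fin n → N) (hG : ∀ x : N, ∃ c : Fin n → R, x = ∑ i, c i • G i)
    (hrel : ∀ c : Fin n → R, ∑ i, c i • G i = 0 → ∀ i, c i ∈ IsLocalRing.maximalIdeal R) :
    minGens R N = n := by
  apply le_antisymm
  · apply Nat.sInf_le
    refine ⟨Fintype.linearCombination R G, fun x => ?_⟩
    obtain ⟨c, rfl⟩ := hG x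
    exact ⟨c, by simp [Fintype.linearCombination_apply]⟩
  · refine le_csInf ⟨n, Fintype.linearCombination R G, fun x => ?_⟩ ?_
    · obtain ⟨c, rfl⟩ := hG x
      exact ⟨c, by simp [Fintype.linearCombination_apply]⟩
    rintro r ⟨ψ, hψ⟩
    choose C hC using fun i => hψ (G i)
    choose D hD using fun j => hG (ψ (Pi.single j 1))
    have hC' : ∀ i, ∑ j, C i j • ψ (Pi.single j 1) = G i := by
      intro i
      rw [← hC i]
      conv_rhs => rw [← (Pi.basisFun R (Fin r)).sum_repr (C i)]
      simp [map_sum]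
    let C' : Matrix (Fin n) (Fin r) R := Matrix.of C
    let D' : Matrix (Fin r) (Fin n) R := Matrix.of D
    have h1 : ∀ i l, (C' * D' - 1 : Matrix (Fin n) (Fin n) R) i l ∈ IsLocalRing.maximalIdeal R := by
      intro i
      apply hrel
      simp only [Matrix.sub_apply, sub_smul, Finset.sum_sub_distrib, Matrix.mul_apply,
        Matrix.one_apply, ite_smul, one_smul, zero_smul, Finset.sum_ite_eq, Finset.mem_univ,
        if_true, Finset.sum_smul]
      rw [Finset.sum_comm, sub_eq_zero]
      rw [← hC' i]
      refine Finset.sum_congr rfl fun j _ => ?_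
      rw [hD j, Finset.smul_sum]
      exact Finset.sum_congr rfl fun l _ => by simp [C', D', mul_smul]
    let π := IsLocalRing.residue R
    have h2 : C'.map π * D'.map π = 1 := by
      rw [← Matrix.map_mul]
      ext i l
      have := (IsLocalRing.residue_eq_zero_iff _).2 (h1 i l)
      rw [Matrix.sub_apply, map_sub, sub_eq_zero] at this
      simp only [Matrix.map_apply, π, this, Matrix.one_apply]
      split_ifs <;> simp
    have h3 := Matrix.rank_mul_le_left (C'.map π) (D'.map π)
    rw [h2, Matrix.rank_one, Fintype.card_fin] at h3
    exact h3.trans ((C'.map π).rank_le_width)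

/-- Relations among a minimal generating system have no unit coefficients. -/
lemma not_isUnit_of_minimal {R N : Type*} [CommRing R] [AddCommGroup N] [Module R N]
    {n : ℕ} (P : (Fin n → R) →ₗ[R] N) (hP : Function.Surjective P) (hn : minGens R N = n)
    (v : Fin n → R) (hv : P v = 0) (i : Fin n) : ¬ IsUnit (v i) := by
  intro hu
  obtain _ | k := n
  · exact i.elim0
  obtain ⟨w, hw⟩ := hu.exists_left_inv
  have : minGens R N ≤ k := by
    apply Nat.sInf_le
    let Q : (Fin k → R) →ₗ[R] (Fin (k+1) → R) :=
      Fintype.linearCombination R (fun j => Pi.single (i.succAbove j) (1 : R))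
    refine ⟨P.comp Q, fun x => ?_⟩
    obtain ⟨u, rfl⟩ := hP x
    let u' : Fin (k+1) → R := u - (u i * w) • v
    have hu' : P u' = P u := by simp [u', hv]
    refine ⟨fun j => u' (i.succAbove j), ?_⟩
    rw [← hu', LinearMap.comp_apply]
    congr 1
    ext l
    simp only [Q, Fintype.linearCombination_apply, Finset.sum_apply, Pi.smul_apply, smul_eq_mul,
      Pi.single_apply]
    induction l using Fin.succAboveCases i with
    | x => simp [u', mul_assoc, hw, (Fin.succAbove_ne i _).symm]
    | p j => simp
  omega

open Ideal.Quotient in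
lemma minGens_dual_of_matrix {A : Type*} [CommRing A] [IsDomain A] [IsLocalRing A]
    (f : A) (hf0 : f ≠ 0) (hfu : ¬ IsUnit f)
    {M : Type*} [AddCommGroup M] [Module (A ⧸ Ideal.span {f}) M] {n : ℕ}
    (Φ Ψ : Matrix (Fin n) (Fin n) A) (h1 : Φ * Ψ = f • 1) (h2 : Ψ * Φ = f • 1)
    (hm : ∀ i j, Φ i j ∈ IsLocalRing.maximalIdeal A)
    (P : (Fin n → A ⧸ Ideal.span {f}) →ₗ[A ⧸ Ideal.span {f}] M) (hP : Function.Surjective P)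
    (hker : ∀ v : Fin n → A, P (fun i => mk _ (v i)) = 0 ↔ ∃ w, v = Φ.mulVec w) :
    minGens (A ⧸ Ideal.span {f}) (M →ₗ[A ⧸ Ideal.span {f}] (A ⧸ Ideal.span {f})) = n := by
  have hne : Ideal.span {f} ≠ ⊤ := by rwa [Ne, Ideal.span_singleton_eq_top]
  have : Nontrivial (A ⧸ Ideal.span {f}) := Ideal.Quotient.nontrivial_iff.2 hne
  have : IsLocalRing (A ⧸ Ideal.span {f}) := IsLocalRing.of_surjective' _ mk_surjective
  have hmk : ∀ a : A, mk (Ideal.span {f}) a = 0 ↔ f ∣ a := fun a => by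
    rw [eq_zero_iff_mem, Ideal.mem_span_singleton]
  have hlift : ∀ u : Fin n → A ⧸ Ideal.span {f}, ∃ v : Fin n → A, u = fun i => mk _ (v i) := by
    intro u
    choose v hv using fun i => mk_surjective (u i)
    exact ⟨v, funext fun i => (hv i).symm⟩
  -- construction of the functionals
  have hG : ∀ i : Fin n, ∃ g : M →ₗ[A ⧸ Ideal.span {f}] (A ⧸ Ideal.span {f}),
      ∀ u : Fin n → A, g (P (fun j => mk _ (u j))) = mk _ (Ψ.mulVec u i) := by
    intro i
    let ℓ : (Fin n → A ⧸ Ideal.span {f}) →ₗ[A ⧸ Ideal.span {f}] (A ⧸ Ideal.span {f}) :=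
      Fintype.linearCombination _ (fun j => mk _ (Ψ i j))
    have hℓ : ∀ u : Fin n → A, ℓ (fun j => mk _ (u j)) = mk _ (Ψ.mulVec u i) := by
      intro u
      simp [ℓ, Fintype.linearCombination_apply, Matrix.mulVec, dotProduct, mul_comm]
    have hle : LinearMap.ker P ≤ LinearMap.ker ℓ := by
      intro u hu
      obtain ⟨v, rfl⟩ := hlift u
      obtain ⟨w, rfl⟩ := (hker v).1 hu
      rw [LinearMap.mem_ker, hℓ, Matrix.mulVec_mulVec, h2, hmk]
      simp [Matrix.smul_mulVec]
    refine ⟨((LinearMap.ker P).liftQ ℓ hle).comp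
      (P.quotKerEquivOfSurjective hP).symm.toLinearMap, fun u => ?_⟩
    rw [← hℓ u]
    have : (P.quotKerEquivOfSurjective hP).symm (P (fun j => mk _ (u j))) =
        (LinearMap.ker P).mkQ (fun j => mk _ (u j)) := by
      rw [LinearEquiv.symm_apply_eq]
      rfl
    simp [this]
  choose G hG using hG
  have hcomb : ∀ (c u : Fin n → A), (∑ i, mk (Ideal.span {f}) (c i) • G i)
      (P (fun j => mk _ (u j))) = mk _ (Matrix.vecMul c Ψ ⬝ᵥ u) := by
    intro c u
    rw [← Matrix.dotProduct_mulVec]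
    simp [hG, dotProduct, LinearMap.sum_apply]
  apply minGens_eq_of_rel G
  · intro h
    choose z hz using fun j => mk_surjective (h (P (Pi.single j 1)))
    have hzu : ∀ u : Fin n → A, h (P (fun j => mk _ (u j))) = mk _ (z ⬝ᵥ u) := by
      intro u
      conv_lhs => rw [← (Pi.basisFun (A ⧸ Ideal.span {f}) (Fin n)).sum_repr (fun j => mk _ (u j))]
      simp [dotProduct, hz, mul_comm]
    have hd : ∀ j, f ∣ Matrix.vecMul z Φ j := by
      intro j
      have h3 := (hker (Φ.mulVec (Pi.single j 1))).2 ⟨_, rfl⟩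
      have h4 := hzu (Φ.mulVec (Pi.single j 1))
      rw [h3, map_zero, Matrix.dotProduct_mulVec, dotProduct_single, mul_one] at h4
      exact (hmk _).1 h4.symm
    choose v hv using hd
    have hv' : Matrix.vecMul z Φ = f • v := by ext j; simp [hv]
    have hzv : z = Matrix.vecMul v Ψ := by
      have h5 : f • z = f • Matrix.vecMul v Ψ := by
        rw [← Matrix.smul_vecMul, ← hv', Matrix.vecMul_vecMul, h1]
        simp [Matrix.vecMul_smul]
      exact smul_right_injective _ hf0 h5
    refine ⟨fun i => mk _ (v i), ?_⟩
    ext x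
    obtain ⟨u, rfl⟩ := hP x
    obtain ⟨u, rfl⟩ := hlift u
    rw [hcomb, hzu, hzv]
  · intro c hc i
    obtain ⟨c, rfl⟩ := hlift c
    have hd : ∀ j, f ∣ Matrix.vecMul c Ψ j := by
      intro j
      have h3 := hcomb c (Pi.single j 1)
      rw [hc, dotProduct_single, mul_one] at h3
      exact (hmk _).1 (by simpa using h3.symm)
    choose w hw using hd
    have hw' : Matrix.vecMul c Ψ = f • w := by ext j; simp [hw]
    have hcw : c = Matrix.vecMul w Φ := by
      have h5 : f • c = f • Matrix.vecMul w Φ := by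
        rw [← Matrix.smul_vecMul, ← hw', Matrix.vecMul_vecMul, h2]
        simp [Matrix.vecMul_smul]
      exact smul_right_injective _ hf0 h5
    have hci : c i ∈ IsLocalRing.maximalIdeal A := by
      rw [hcw, Matrix.vecMul, dotProduct]
      exact Ideal.sum_mem _ fun j _ => Ideal.mul_mem_left _ _ (hm j i)
    rw [IsLocalRing.mem_maximalIdeal, mem_nonunits_iff]
    intro hu
    obtain ⟨d, hd⟩ := hu.exists_left_inv
    obtain ⟨d, rfl⟩ := mk_surjective d
    have h6 : f ∣ d * c i - 1 := by
      rw [← hmk, map_sub, map_mul, hd, map_one, sub_self]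
    have h7 : d * c i - 1 ∈ IsLocalRing.maximalIdeal A :=
      Ideal.mem_of_dvd _ h6 ((IsLocalRing.mem_maximalIdeal f).2 hfu)
    have h8 := Ideal.sub_mem _ (Ideal.mul_mem_left _ d hci) h7
    rw [sub_sub_cancel] at h8
    exact (IsLocalRing.mem_maximalIdeal _).1 h8 isUnit_one

open Ideal.Quotient in
lemma minGens_dual_abstract {A B : Type*} [CommRing A] [IsDomain A] [IsLocalRing A]
    [IsNoetherianRing A] [CommRing B] [IsDomain B] [IsPrincipalIdealRing B]
    (ev : A →+* B) (hs : Function.Surjective ev) (t : A) (ht0 : t ≠ 0) (htu : ¬ IsUnit t)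
    (hker : ∀ a, ev a = 0 → t ∣ a) (hevt : ev t = 0)
    (f : A) (hf0 : f ≠ 0) (hfu : ¬ IsUnit f) (hevf : ev f ≠ 0)
    (M : Type*) [AddCommGroup M] [Module (A ⧸ Ideal.span {f}) M]
    [Module.Finite (A ⧸ Ideal.span {f}) M]
    (htf : ∀ r : A ⧸ Ideal.span {f}, r ∈ nonZeroDivisors (A ⧸ Ideal.span {f}) →
      Function.Injective (fun m : M => r • m)) :
    minGens (A ⧸ Ideal.span {f}) M =
      minGens (A ⧸ Ideal.span {f}) (M →ₗ[A ⧸ Ideal.span {f}] (A ⧸ Ideal.span {f})) := by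
  have hmk : ∀ a : A, mk (Ideal.span {f}) a = 0 ↔ f ∣ a := fun a => by
    rw [eq_zero_iff_mem, Ideal.mem_span_singleton]
  have htnz : mk (Ideal.span {f}) t ∈ nonZeroDivisors (A ⧸ Ideal.span {f}) := by
    rw [mem_nonZeroDivisors_iff_right]
    intro g hg
    obtain ⟨g, rfl⟩ := mk_surjective g
    rw [← map_mul, hmk] at hg
    obtain ⟨h, hh⟩ := hg
    have h1 : ev f * ev h = 0 := by rw [← map_mul, ← hh, map_mul, hevt, mul_zero]
    obtain ⟨h', rfl⟩ := hker _ ((mul_eq_zero.1 h1).resolve_left hevf)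
    rw [hmk]
    exact ⟨h', mul_right_cancel₀ ht0 (by rw [hh]; ring)⟩
  have hne : {r : ℕ | ∃ φ : (Fin r → A ⧸ Ideal.span {f}) →ₗ[A ⧸ Ideal.span {f}] M,
      Function.Surjective φ}.Nonempty := Module.Finite.exists_fin' _ _
  obtain ⟨n, hn⟩ : ∃ n, minGens (A ⧸ Ideal.span {f}) M = n := ⟨_, rfl⟩
  have hmem := Nat.sInf_mem hne
  change minGens (A ⧸ Ideal.span {f}) M ∈ _ at hmem
  rw [hn] at hmem
  obtain ⟨P, hP⟩ := hmem
  let K : Submodule A (Fin n → A) :=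
    { carrier := {v | P (fun i => mk _ (v i)) = 0}
      add_mem' := by
        intro v w hv hw
        have : (fun i => mk (Ideal.span {f}) ((v + w) i)) =
          (fun i => mk _ (v i)) + (fun i => mk _ (w i)) := by ext i; simp
        simp only [Set.mem_ofPred_eq] at hv hw ⊢
        rw [this, map_add, hv, hw, add_zero]
      zero_mem' := by
        have : (fun i => mk (Ideal.span {f}) ((0 : Fin n → A) i)) = 0 := by ext i; simp
        simp only [Set.mem_ofPred_eq]
        rw [this, map_zero]
      smul_mem' := by
        intro a v hv
        have : (fun i => mk (Ideal.span {f}) ((a • v) i)) =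
          mk (Ideal.span {f}) a • (fun i => mk _ (v i)) := by ext i; simp
        simp only [Set.mem_ofPred_eq] at hv ⊢
        rw [this, map_smul, hv, smul_zero] }
  have hKmem : ∀ v, v ∈ K ↔ P (fun i => mk _ (v i)) = 0 := fun v => Iff.rfl
  have hKt : ∀ v, t • v ∈ K → v ∈ K := by
    intro v hv
    rw [hKmem] at hv ⊢
    have : (fun i => mk (Ideal.span {f}) ((t • v) i)) =
          mk (Ideal.span {f}) t • (fun i => mk _ (v i)) := by ext i; simp
    rw [this, map_smul] at hv
    exact htf _ htnz (by simpa using hv)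
  obtain ⟨m, k, hli, hspan⟩ := exists_free_gens ev hs t ht0 htu hker K hKt
  have hrange : ∀ v, v ∈ K ↔ ∃ w : Fin m → A, v = ∑ j, w j • k j := by
    intro v
    rw [← hspan, Submodule.mem_span_range_iff_exists_fun]
    exact exists_congr fun w => eq_comm
  have hfK : ∀ j : Fin n, Pi.single j f ∈ K := by
    intro j
    rw [hKmem]
    have : (fun i => mk (Ideal.span {f}) ((Pi.single j f : Fin n → A) i)) = 0 := by
      ext i
      by_cases h : i = j
      · subst h; simp
      · simp [h]
    rw [this, map_zero]
  choose W hW using fun j => (hrange _).1 (hfK j)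
  let Φ' : Matrix (Fin n) (Fin m) A := Matrix.of fun i j => k j i
  let Ψ' : Matrix (Fin m) (Fin n) A := Matrix.of fun i j => W j i
  have hΦΨ' : Φ' * Ψ' = f • 1 := by
    ext i j
    have := congrFun (hW j) i
    simp only [Finset.sum_apply, Pi.smul_apply, smul_eq_mul] at this
    simp only [Matrix.mul_apply, Φ', Ψ', Matrix.of_apply, Matrix.smul_apply, Matrix.one_apply]
    rw [show ∑ l, k l i * W j l = ∑ l, W j l * k l i from
      Finset.sum_congr rfl fun _ _ => mul_comm _ _, ← this]
    simp [Pi.single_apply]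
  have hΦinj' : Function.Injective Φ'.mulVec := by
    rw [Matrix.mulVec_injective_iff]
    exact hli
  have hΨinj' : Function.Injective Ψ'.mulVec := by
    intro x y hxy
    have := congrArg Φ'.mulVec hxy
    simp only [Matrix.mulVec_mulVec, hΦΨ', Matrix.smul_mulVec, Matrix.one_mulVec] at this
    exact smul_right_injective _ hf0 this
  have hmn : m = n := le_antisymm (le_of_fin_injective A Φ'.mulVecLin hΦinj')
    (le_of_fin_injective A Ψ'.mulVecLin hΨinj')
  subst hmn
  have hΨΦ' : Ψ' * Φ' = f • 1 := by
    have h1 : Φ' * (Ψ' * Φ') = Φ' * (f • 1) := by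
      rw [← Matrix.mul_assoc, hΦΨ']; simp
    apply Matrix.ext_of_mulVec_single
    intro i
    apply hΦinj'
    rw [Matrix.mulVec_mulVec, h1, Matrix.mulVec_mulVec]
  have hPk : ∀ v : Fin m → A, P (fun i => mk _ (v i)) = 0 ↔ ∃ w, v = Φ'.mulVec w := by
    intro v
    rw [← hKmem, hrange]
    refine exists_congr fun w => ?_
    have : ∑ j, w j • k j = Φ'.mulVec w := by
      ext i
      simp [Φ', Matrix.mulVec, dotProduct, mul_comm]
    rw [this]
  rw [hn]
  symm
  refine minGens_dual_of_matrix f hf0 hfu Φ' Ψ' hΦΨ' hΨΦ' ?_ P hP hPk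
  intro i j
  rw [IsLocalRing.mem_maximalIdeal, mem_nonunits_iff]
  intro hu
  have h1 : P (fun i => mk _ (k j i)) = 0 := by
    rw [← hKmem, ← hspan]
    exact Submodule.subset_span ⟨j, rfl⟩
  exact not_isUnit_of_minimal P hP hn _ h1 i (hu.map (mk (Ideal.span {f})))

noncomputable abbrev mon2 (i j : ℕ) : Fin 2 →₀ ℕ := Finsupp.single 0 i + Finsupp.single 1 j

def ofCoeffs (a : (Fin 2 →₀ ℕ) → ℂ) : MvPowerSeries (Fin 2) ℂ := a

lemma coeff_ofCoeffs (a : (Fin 2 →₀ ℕ) → ℂ) (e : Fin 2 →₀ ℕ) :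
    MvPowerSeries.coeff e (ofCoeffs a) = a e := rfl

lemma mon2_surj (e : Fin 2 →₀ ℕ) : mon2 (e 0) (e 1) = e := by
  ext i; fin_cases i <;> simp

noncomputable def evc (c : ℂ) : MvPowerSeries (Fin 2) ℂ →+* PowerSeries ℂ :=
  (MvPowerSeries.rename (R := ℂ) (fun _ : Fin 2 => ())).toRingHom.comp
    (MvPowerSeries.rescale ![c, 1])

lemma coeff_evc (c : ℂ) (g : MvPowerSeries (Fin 2) ℂ) (d : ℕ) :
    PowerSeries.coeff d (evc c g) =
      ∑ k ∈ Finset.range (d + 1), c ^ k * MvPowerSeries.coeff (mon2 k (d - k)) g := by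
  have h : PowerSeries.coeff d (evc c g) = MvPowerSeries.coeff (Finsupp.single () d)
    (MvPowerSeries.rename (R := ℂ) (fun _ : Fin 2 => ()) (MvPowerSeries.rescale ![c, 1] g)) := rfl
  rw [h, MvPowerSeries.coeff_rename]
  symm
  refine Finset.sum_bij (fun k _ => mon2 k (d - k)) ?_ ?_ ?_ ?_
  · intro k hk
    simp only [Set.Finite.mem_toFinset, Set.mem_preimage, Set.mem_singleton_iff]
    simp only [mon2, Finsupp.mapDomain_add, Finsupp.mapDomain_single, ← Finsupp.single_add]
    rw [Nat.add_sub_cancel' (by simpa [Nat.lt_succ_iff] using hk)]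
  · intro a _ b _ hab
    simpa using DFunLike.congr_fun hab 0
  · intro e he
    simp only [Set.Finite.mem_toFinset, Set.mem_preimage, Set.mem_singleton_iff] at he
    rw [← mon2_surj e] at he ⊢
    simp only [mon2, Finsupp.mapDomain_add, Finsupp.mapDomain_single, ← Finsupp.single_add] at he
    have he' : e 0 + e 1 = d := by simpa using DFunLike.congr_fun he ()
    refine ⟨e 0, by simp; omega, ?_⟩
    rw [show d - e 0 = e 1 by omega]
  · intro k hk
    rw [MvPowerSeries.coeff_rescale]
    simp [Finsupp.prod_fintype, Fin.prod_univ_two]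

lemma evc_surjective (c : ℂ) : Function.Surjective (evc c) := by
  intro g
  refine ⟨ofCoeffs fun e => if e 0 = 0 then PowerSeries.coeff (e 1) g else 0, ?_⟩
  ext d
  rw [coeff_evc, Finset.sum_eq_single 0]
  · simp [coeff_ofCoeffs]
  · intro k _ hk
    simp [coeff_ofCoeffs, hk]
  · simp

noncomputable abbrev tc (c : ℂ) : MvPowerSeries (Fin 2) ℂ :=
  MvPowerSeries.X 0 - MvPowerSeries.C c * MvPowerSeries.X 1

lemma evc_tc (c : ℂ) : evc c (tc c) = 0 := by
  have hX : ∀ s : Fin 2, MvPowerSeries.rescale ![c, 1] (MvPowerSeries.X s) =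
      MvPowerSeries.C (![c, 1] s) * MvPowerSeries.X s := by
    intro s
    ext n
    rw [MvPowerSeries.coeff_rescale, MvPowerSeries.coeff_C_mul, MvPowerSeries.coeff_X]
    split_ifs with h
    · subst h
      simp
    · simp
  have hC : MvPowerSeries.rescale ![c, 1] (MvPowerSeries.C c) = MvPowerSeries.C c := by
    ext n
    rw [MvPowerSeries.coeff_rescale, MvPowerSeries.coeff_C]
    split_ifs with h
    · subst h
      simp
    · simp
  simp [evc, tc, hX, hC]

lemma tc_dvd (c : ℂ) (g : MvPowerSeries (Fin 2) ℂ) (hg : evc c g = 0) : tc c ∣ g := by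
  let q : MvPowerSeries (Fin 2) ℂ := ofCoeffs fun e =>
    ∑ k ∈ Finset.range (e 1 + 1), c ^ k * MvPowerSeries.coeff (mon2 (e 0 + 1 + k) (e 1 - k)) g
  have hq : ∀ i j, MvPowerSeries.coeff (mon2 i j) q =
    ∑ k ∈ Finset.range (j + 1), c ^ k * MvPowerSeries.coeff (mon2 (i + 1 + k) (j - k)) g := by
    intro i j
    simp [q, coeff_ofCoeffs]
  refine ⟨q, ?_⟩
  ext e
  rw [← mon2_surj e]
  generalize e 0 = i
  generalize e 1 = j
  have hX : ∀ (s : Fin 2) (e : Fin 2 →₀ ℕ), MvPowerSeries.coeff e (MvPowerSeries.X s * q) =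
      if e s = 0 then 0 else MvPowerSeries.coeff (e - Finsupp.single s 1) q := by
    intro s e
    rw [MvPowerSeries.X, MvPowerSeries.coeff_monomial_mul]
    by_cases h : e s = 0
    · simp [h]
    · simp [h, Nat.one_le_iff_ne_zero]
  have hm0 : mon2 i j - Finsupp.single 0 1 = mon2 (i - 1) j := by
    ext l; fin_cases l <;> simp
  have hm1 : mon2 i j - Finsupp.single 1 1 = mon2 i (j - 1) := by
    ext l; fin_cases l <;> simp
  rw [sub_mul, map_sub, mul_assoc, MvPowerSeries.coeff_C_mul, hX, hX, hm0, hm1, hq, hq]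
  have key : ∀ i j, j ≠ 0 → ∑ k ∈ Finset.range (j + 1), c ^ k * MvPowerSeries.coeff (mon2 (i + k) (j - k)) g =
      MvPowerSeries.coeff (mon2 i j) g + c * ∑ k ∈ Finset.range (j - 1 + 1), c ^ k * MvPowerSeries.coeff (mon2 (i + 1 + k) (j - 1 - k)) g := by
    intro i j hj
    rw [Finset.sum_range_succ', Nat.sub_add_cancel (Nat.one_le_iff_ne_zero.2 hj), add_comm, Finset.mul_sum]
    congr 1
    · simp
    · refine Finset.sum_congr rfl fun k _ => ?_
      rw [pow_succ', mul_assoc, show i + (k + 1) = i + 1 + k by ring,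
        show j - (k + 1) = j - 1 - k by omega]
  have h0 := coeff_evc c g j
  rw [hg, map_zero] at h0
  have key0 := key 0 j
  simp only [zero_add] at key0
  rcases Nat.eq_zero_or_pos i with rfl | hi <;> rcases Nat.eq_zero_or_pos j with rfl | hj
  · simpa using h0.symm
  · have := key0 hj.ne'
    rw [← h0] at this
    simp [hj.ne']
    linear_combination -this
  · obtain ⟨i, rfl⟩ := Nat.exists_eq_succ_of_ne_zero hi.ne'
    simp
  · obtain ⟨i, rfl⟩ := Nat.exists_eq_succ_of_ne_zero hi.ne'
    have := key (i+1) j hj.ne'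
    simp [hj.ne']
    linear_combination -this

lemma exists_evc_ne (f : MvPowerSeries (Fin 2) ℂ) (hf : f ≠ 0) : ∃ c, evc c f ≠ 0 := by
  by_contra! h
  apply hf
  ext e
  rw [← mon2_surj e]
  generalize e 0 = i
  generalize e 1 = j
  let p : Polynomial ℂ := ∑ k ∈ Finset.range (i + j + 1),
    Polynomial.monomial k (MvPowerSeries.coeff (mon2 k (i + j - k)) f)
  have hp : p = 0 := by
    apply Polynomial.funext
    intro c
    have := coeff_evc c f (i + j)
    rw [h, map_zero] at this
    simp [p, Polynomial.eval_finsetSum, this, mul_comm]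
  have h2 := congrArg (fun p => Polynomial.coeff p i) hp
  simp only [p, Polynomial.finsetSum_coeff, Polynomial.coeff_monomial] at h2
  rw [Finset.sum_ite_eq' , if_pos (by simp)] at h2
  simpa using h2

lemma tc_ne_zero (c : ℂ) : tc c ≠ 0 := by
  intro h
  have := congrArg (MvPowerSeries.coeff (mon2 1 0)) h
  simp [MvPowerSeries.coeff_X, MvPowerSeries.coeff_C_mul] at this
  rw [if_neg] at this
  · simp at this
  · intro h
    simpa using DFunLike.congr_fun h 0

lemma tc_not_isUnit (c : ℂ) : ¬ IsUnit (tc c) := by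
  intro h
  have := h.map (MvPowerSeries.constantCoeff (σ := Fin 2) (R := ℂ))
  simp at this

/-- Let `O = ℂ[[x,y]]/(f)` be reduced, with `f` a nonzero non-unit, and let `M` be a
nonzero finitely generated torsion-free `O`-module.  Then `M` and `Hom_O(M, O)` have
the same minimal number of generators. -/
theorem minGens_dual_eq (f : MvPowerSeries (Fin 2) ℂ) (hf0 : f ≠ 0) (hfu : ¬ IsUnit f)
    (hred : IsReduced (MvPowerSeries (Fin 2) ℂ ⧸ Ideal.span {f}))
    (M : Type*) [AddCommGroup M]
    [Module (MvPowerSeries (Fin 2) ℂ ⧸ Ideal.span {f}) M]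
    [Nontrivial M]
    [Module.Finite (MvPowerSeries (Fin 2) ℂ ⧸ Ideal.span {f}) M]
    (htf : ∀ r : MvPowerSeries (Fin 2) ℂ ⧸ Ideal.span {f}, r ∈ nonZeroDivisors
        (MvPowerSeries (Fin 2) ℂ ⧸ Ideal.span {f}) →
      Function.Injective (fun m : M => r • m)) :
    minGens (MvPowerSeries (Fin 2) ℂ ⧸ Ideal.span {f}) M =
      minGens (MvPowerSeries (Fin 2) ℂ ⧸ Ideal.span {f})
        (M →ₗ[MvPowerSeries (Fin 2) ℂ ⧸ Ideal.span {f}]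
          (MvPowerSeries (Fin 2) ℂ ⧸ Ideal.span {f})) := by
  obtain ⟨c, hc⟩ := exists_evc_ne f hf0
  have : IsDomain (MvPowerSeries (Fin 2) ℂ) := NoZeroDivisors.to_isDomain _
  exact minGens_dual_abstract (evc c) (evc_surjective c) (tc c) (tc_ne_zero c)
    (tc_not_isUnit c) (tc_dvd c) (evc_tc c) f hf0 hfu hc M htf
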